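/- arXiv:2501.05761 — 2 statements merged into one kernel-verified Lean document; each statement's English description precedes it below -/
import Mathlib

section
/- Let S be a nonempty finite set, let P : S × S → ℝ be a row-stochastic transition matrix (P(x,y) ≥ 0 for all x,y and ∑_y P(x,y) = 1 for all x), and let π be a probability distribution on S satisfying detailed balance with respect to P (π(x)·P(x,y) = π(y)·P(y,x) for all x,y ∈ S). Fix k ≥ 1 and let μ_k be the probability measure on paths x = (x_0, x_1, …, x_k) ∈ S^{k+1} defined by μ_k(x) = π(x_0)·∏_{i=0}^{k-1} P(x_i, x_{i+1}). Let ω : S → ℝ be any label function. Then for every ε with 0 < ε, the μ_k-probability of the set of paths x such that #{ i ∈ {0,…,k} : ω(x_i) ≤ ω(x_0) } ≤ ε(k+1) is at most √(2ε). -/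
open scoped Classical BigOperators

namespace ReversibleChain

variable {S : Type*} [Fintype S]

/-- The expectation of `g` applied to the list of the `n` states visited after the start `x` by the
chain with transition matrix `P`. -/
def pathExp (P : S → S → ℝ) : ℕ → S → (List S → ℝ) → ℝ
  | 0, _, g => g []
  | n + 1, x, g => ∑ y, P x y * pathExp P n y (fun l => g (y :: l))

lemma pathExp_sum {ι : Type*} (P : S → S → ℝ) (n : ℕ) (x : S) (s : Finset ι) (c : ι → ℝ)
    (g : ι → List S → ℝ) :
    pathExp P n x (fun l => ∑ z ∈ s, c z * g z l) = ∑ z ∈ s, c z * pathExp P n x (g z) := by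
  induction n generalizing x g with
  | zero => rfl
  | succ n ih =>
    simp only [pathExp, ih, Finset.mul_sum]
    rw [Finset.sum_comm]
    exact Finset.sum_congr rfl fun _ _ => Finset.sum_congr rfl fun _ _ => by ring

lemma pathExp_const_mul (P : S → S → ℝ) (n : ℕ) (x : S) (c : ℝ) (g : List S → ℝ) :
    pathExp P n x (fun l => c * g l) = c * pathExp P n x g := by
  simpa using pathExp_sum P n x {()} (fun _ => c) (fun _ => g)

lemma pathExp_mono {P : S → S → ℝ} (hP0 : ∀ x y, 0 ≤ P x y) {n : ℕ} {x : S} {f g : List S → ℝ}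
    (h : ∀ l, l.length = n → f l ≤ g l) : pathExp P n x f ≤ pathExp P n x g := by
  induction n generalizing x f g with
  | zero => exact h [] rfl
  | succ n ih =>
    exact Finset.sum_le_sum fun y _ => mul_le_mul_of_nonneg_left
      (ih fun l hl => h _ (by simp [hl])) (hP0 x y)

lemma pathExp_const {P : S → S → ℝ} (hP1 : ∀ x, ∑ y, P x y = 1) (n : ℕ) (x : S) (c : ℝ) :
    pathExp P n x (fun _ => c) = c := by
  induction n generalizing x with
  | zero => rfl
  | succ n ih => simp only [pathExp, ih, ← Finset.sum_mul, hP1, one_mul]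

lemma pathExp_nonneg {P : S → S → ℝ} (hP0 : ∀ x y, 0 ≤ P x y) (hP1 : ∀ x, ∑ y, P x y = 1)
    {n : ℕ} {x : S} {g : List S → ℝ} (hg : ∀ l, 0 ≤ g l) : 0 ≤ pathExp P n x g :=
  (pathExp_const hP1 n x 0).ge.trans (pathExp_mono hP0 fun l _ => hg l)

lemma pathExp_antitone {P : S → S → ℝ} (hP0 : ∀ x y, 0 ≤ P x y) (hP1 : ∀ x, ∑ y, P x y = 1)
    (x : S) {g : List S → ℝ} (hg : ∀ l y, g (l ++ [y]) ≤ g l) :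
    Antitone fun n => pathExp P n x g := by
  refine antitone_nat_of_succ_le fun n => ?_
  induction n generalizing x g with
  | zero =>
    calc ∑ y, P x y * g [y] ≤ ∑ y, P x y * g [] :=
          Finset.sum_le_sum fun y _ => mul_le_mul_of_nonneg_left (hg [] y) (hP0 x y)
      _ = g [] := by rw [← Finset.sum_mul, hP1, one_mul]
  | succ n ih =>
    exact Finset.sum_le_sum fun y _ => mul_le_mul_of_nonneg_left
      (ih y fun l z => hg (y :: l) z) (hP0 x y)

lemma pathExp_eq_sum (P : S → S → ℝ) (n : ℕ) (x : S) (g : List S → ℝ) :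
    pathExp P n x g = ∑ v : Fin n → S,
      (∏ i : Fin n, P ((Fin.cons x v : Fin (n + 1) → S) i.castSucc) (v i)) * g (List.ofFn v) := by
  induction n generalizing x g with
  | zero => simp [pathExp]
  | succ n ih =>
    rw [← (Fin.consEquiv fun _ => S).sum_comp, Fintype.sum_prod_type]
    refine Finset.sum_congr rfl fun y _ => ?_
    rw [ih, Finset.mul_sum]
    refine Finset.sum_congr rfl fun v _ => ?_
    simp [Fin.prod_univ_succ, List.ofFn_succ, mul_assoc]

lemma sum_pathExp_eq (P : S → S → ℝ) (π : S → ℝ) (n : ℕ) (g : List S → ℝ) :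
    ∑ s, π s * pathExp P n s (fun r => g (s :: r)) = ∑ x : Fin (n + 1) → S,
      (π (x 0) * ∏ i : Fin n, P (x i.castSucc) (x i.succ)) * g (List.ofFn x) := by
  rw [← (Fin.consEquiv fun _ => S).sum_comp, Fintype.sum_prod_type]
  refine Finset.sum_congr rfl fun s _ => ?_
  rw [pathExp_eq_sum, Finset.mul_sum]
  refine Finset.sum_congr rfl fun v _ => ?_
  simp [List.ofFn_succ, mul_assoc]

/-- A reversible chain may be run in both directions from the state at time `a`. -/
lemma sum_pathExp_pathExp {P : S → S → ℝ} {π : S → ℝ}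
    (hdb : ∀ x y, π x * P x y = π y * P y x) (a b : ℕ) (g : List S → ℝ) :
    ∑ s, π s * pathExp P a s (fun l => pathExp P b s fun r => g (l.reverseAux (s :: r))) =
      ∑ s, π s * pathExp P (a + b) s fun r => g (s :: r) := by
  induction a generalizing b with
  | zero => simp [pathExp]
  | succ a ih =>
    rw [show a + 1 + b = a + (b + 1) by ring, ← ih]
    simp only [pathExp, pathExp_sum, Finset.mul_sum]
    rw [Finset.sum_comm]
    refine Finset.sum_congr rfl fun s _ => Finset.sum_congr rfl fun z _ => ?_
    rw [← mul_assoc, ← mul_assoc, hdb z s]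
    rfl

end ReversibleChain

lemma List.countP_ofFn {α : Type*} {n : ℕ} (v : Fin n → α) (p : α → Prop) :
    (List.ofFn v).countP (fun a => decide (p a)) =
      (Finset.univ.filter fun i => p (v i)).card := by
  induction n with
  | zero => simp
  | succ n ih =>
    rw [List.ofFn_succ, List.countP_cons, ih, Fin.card_filter_univ_succ]
    simp only [decide_eq_true_eq]
    split_ifs <;> simp

/-- At most `M` indices have rank at most `M`. -/
lemma card_filter_rank_le {ι : Type*} [Fintype ι] (v : ι → ℝ) {M : ℝ} (hM : 0 ≤ M) :
    ((Finset.univ.filter fun j =>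
      ((Finset.univ.filter fun i => v i ≤ v j).card : ℝ) ≤ M).card : ℝ) ≤ M := by
  set J := Finset.univ.filter fun j => ((Finset.univ.filter fun i => v i ≤ v j).card : ℝ) ≤ M
    with hJ
  rcases J.eq_empty_or_nonempty with h | h
  · simpa [h] using hM
  · obtain ⟨j, hj, hmax⟩ := J.exists_max_image v h
    have hsub : J ⊆ Finset.univ.filter fun i => v i ≤ v j := fun i hi => by
      simpa using hmax i hi
    exact (Nat.cast_le.mpr (Finset.card_le_card hsub)).trans (Finset.mem_filter.mp hj).2

/-- CFP outlier test: for a reversible Markov chain started from a distribution `π`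
in detailed balance with the row-stochastic transition matrix `P`, the probability
(under the stationary path measure on trajectories `x : Fin (k+1) → S`) that the
starting label `ω (x 0)` is an `ε`-outlier of the trajectory, i.e. that
`#{i : ω (x i) ≤ ω (x 0)} ≤ ε (k+1)`, is at most `√(2 ε)`. -/
theorem cfp_outlier_test {S : Type*} [Fintype S] [Nonempty S]
    (P : S → S → ℝ) (hP0 : ∀ x y, 0 ≤ P x y) (hP1 : ∀ x, ∑ y, P x y = 1)
    (π : S → ℝ) (hπ0 : ∀ x, 0 ≤ π x) (hπ1 : ∑ x, π x = 1)
    (hdb : ∀ x y, π x * P x y = π y * P y x)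
    (k : ℕ) (hk : 1 ≤ k) (ω : S → ℝ) (ε : ℝ) (hε : 0 < ε) :
    ∑ x ∈ Finset.univ.filter (fun x : Fin (k + 1) → S =>
        ((Finset.univ.filter (fun i : Fin (k + 1) => ω (x i) ≤ ω (x 0))).card : ℝ)
          ≤ ε * (k + 1)),
      π (x 0) * ∏ i : Fin k, P (x i.castSucc) (x i.succ)
    ≤ Real.sqrt (2 * ε) := by
  set c : ℝ := ε * (k + 1) with hc
  have hc0 : 0 ≤ c := by positivity
  let μ : (Fin (k + 1) → S) → ℝ := fun x => π (x 0) * ∏ i : Fin k, P (x i.castSucc) (x i.succ)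
  have hμ0 : ∀ x, 0 ≤ μ x := fun x =>
    mul_nonneg (hπ0 _) (Finset.prod_nonneg fun i _ => hP0 _ _)
  have hμ1 : ∑ x, μ x = 1 := by
    have := ReversibleChain.sum_pathExp_eq P π k fun _ => 1
    simpa only [ReversibleChain.pathExp_const hP1, mul_one, hπ1] using this.symm
  let N : S → List S → ℕ := fun s l => l.countP fun y => decide (ω y ≤ ω s)
  let f : S → List S → ℝ := fun s l => if (N s (s :: l) : ℝ) ≤ c then 1 else 0
  have hf0 : ∀ s l, 0 ≤ f s l := fun s l => by dsimp only [f]; split_ifs <;> norm_num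
  have hf : ∀ s l y, f s (l ++ [y]) ≤ f s l := fun s l y => by
    have h : (N s (s :: l) : ℝ) ≤ N s (s :: (l ++ [y])) := by
      rw [← List.cons_append]
      simp only [N, List.countP_append]
      push_cast
      exact le_add_of_nonneg_right (Nat.cast_nonneg _)
    dsimp only [f]
    split_ifs <;> linarith
  let A : ℕ → S → ℝ := fun n s => ReversibleChain.pathExp P n s (f s)
  have hA0 : ∀ n s, 0 ≤ A n s := fun n s => ReversibleChain.pathExp_nonneg hP0 hP1 (hf0 s)
  have hA : ∀ s, Antitone fun n => A n s := fun s =>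
    ReversibleChain.pathExp_antitone hP0 hP1 s (hf s)
  let H : ℕ → List S → ℝ := fun j L =>
    L[j]?.elim 0 fun s => if (N s L : ℝ) ≤ 2 * c then 1 else 0
  have hprob : ∑ x ∈ Finset.univ.filter (fun x : Fin (k + 1) → S =>
        ((Finset.univ.filter (fun i : Fin (k + 1) => ω (x i) ≤ ω (x 0))).card : ℝ) ≤ c), μ x =
      ∑ s, π s * A k s := by
    have h := ReversibleChain.sum_pathExp_eq P π k
      (fun L => L.head?.elim 0 fun s => f s L.tail)
    refine Eq.trans ?_ h.symm
    rw [Finset.sum_filter]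
    refine Finset.sum_congr rfl fun x _ => ?_
    have hx : N (x 0) (List.ofFn x) =
        (Finset.univ.filter (fun i : Fin (k + 1) => ω (x i) ≤ ω (x 0))).card :=
      List.countP_ofFn x fun y => ω y ≤ ω (x 0)
    have hx' : ((List.ofFn x).head?.elim 0 fun s => f s (List.ofFn x).tail) =
        if (N (x 0) (List.ofFn x) : ℝ) ≤ c then (1 : ℝ) else 0 := by
      simp only [List.ofFn_succ, List.head?_cons, List.tail_cons, Option.elim_some, f]
    rw [hx', hx]
    split_ifs <;> simp [μ]
  have hlower : ∀ j ∈ Finset.range (k + 1),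
      ∑ s, π s * A k s ^ 2 ≤ ∑ x, μ x * H j (List.ofFn x) := by
    intro j hj
    have hjk : j ≤ k := Nat.lt_succ_iff.mp (Finset.mem_range.mp hj)
    have h := ReversibleChain.sum_pathExp_pathExp hdb j (k - j) (H j)
    rw [Nat.add_sub_cancel' hjk, ReversibleChain.sum_pathExp_eq] at h
    refine le_of_le_of_eq (Finset.sum_le_sum fun s _ =>
      mul_le_mul_of_nonneg_left ?_ (hπ0 s)) h
    calc A k s ^ 2 ≤ A (k - j) s * A j s := by
          rw [sq]
          exact mul_le_mul (hA s (Nat.sub_le k j)) (hA s hjk) (hA0 k s) (hA0 _ s)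
      _ = ReversibleChain.pathExp P j s fun l =>
            ReversibleChain.pathExp P (k - j) s fun r => f s l * f s r := by
          simp only [ReversibleChain.pathExp_const_mul]
          simp only [mul_comm (f s _), ReversibleChain.pathExp_const_mul]
          rfl
      _ ≤ _ := ReversibleChain.pathExp_mono hP0 fun l hl =>
          ReversibleChain.pathExp_mono hP0 fun r _ => ?_
    have hget : (l.reverseAux (s :: r))[j]? = some s := by
      simp [List.reverseAux_eq, hl]
    have hN : (N s (l.reverseAux (s :: r)) : ℝ) ≤ N s (s :: l) + N s (s :: r) := by
      simp only [N, List.reverseAux_eq, List.countP_append, List.countP_reverse,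
        List.countP_cons]
      push_cast
      have : (0 : ℝ) ≤ if decide (ω s ≤ ω s) = true then 1 else 0 := by split_ifs <;> norm_num
      linarith
    simp only [H, hget, Option.elim_some, f]
    split_ifs <;> linarith
  have hupper : ∀ x : Fin (k + 1) → S,
      ∑ j ∈ Finset.range (k + 1), H j (List.ofFn x) ≤ 2 * c := by
    intro x
    refine le_of_eq_of_le ?_
      (card_filter_rank_le (fun i => ω (x i)) (by positivity : 0 ≤ 2 * c))
    rw [Finset.sum_range, Finset.card_filter, Nat.cast_sum]
    refine Finset.sum_congr rfl fun j _ => ?_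
    have hx : N (x j) (List.ofFn x) =
        (Finset.univ.filter (fun i : Fin (k + 1) => ω (x i) ≤ ω (x j))).card :=
      List.countP_ofFn x fun y => ω y ≤ ω (x j)
    have hget : (List.ofFn x)[(j : ℕ)]? = some (x j) := by
      rw [List.getElem?_ofFn, dif_pos j.isLt]
    simp only [H, hget, Option.elim_some, hx]
    split_ifs <;> simp
  have hsum : ((k : ℝ) + 1) * ∑ s, π s * A k s ^ 2 ≤ 2 * c := by
    calc ((k : ℝ) + 1) * ∑ s, π s * A k s ^ 2
        ≤ ∑ j ∈ Finset.range (k + 1), ∑ x, μ x * H j (List.ofFn x) := by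
          simpa using Finset.card_nsmul_le_sum _ _ _ hlower
      _ = ∑ x, μ x * ∑ j ∈ Finset.range (k + 1), H j (List.ofFn x) := by
          rw [Finset.sum_comm]
          simp only [Finset.mul_sum]
      _ ≤ ∑ x, μ x * (2 * c) :=
          Finset.sum_le_sum fun x _ => mul_le_mul_of_nonneg_left (hupper x) (hμ0 x)
      _ = 2 * c := by rw [← Finset.sum_mul, hμ1, one_mul]
  change ∑ x ∈ _, μ x ≤ _
  rw [hprob]
  refine Real.le_sqrt_of_sq_le ?_
  have hjensen : (∑ s, π s * A k s) ^ 2 ≤ ∑ s, π s * A k s ^ 2 :=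
    Real.pow_arith_mean_le_arith_mean_pow _ _ _ (fun s _ => hπ0 s) hπ1 (fun s _ => hA0 k s) 2
  refine hjensen.trans (le_of_mul_le_mul_left (hsum.trans_eq ?_) (by positivity : (0 : ℝ) < k + 1))
  rw [hc]
  ring
end

section
/- Let S be a nonempty finite set, let P : S × S → ℝ be a row-stochastic transition matrix, and let π be a probability distribution on S satisfying detailed balance with respect to P. Fix k ≥ 1 and ε > 0. For σ ∈ S, let μ_k^σ be the probability measure on paths (x_0,…,x_k) ∈ S^{k+1} with x_0 = σ given by ∏_{i=0}^{k-1} P(x_i, x_{i+1}), and let p(σ) be the μ_k^σ-probability that #{ i ∈ {0,…,k} : ω(x_i) ≤ ω(x_0) } ≤ ε(k+1), where ω : S → ℝ is a label function. Fix α > 0 and suppose σ_0 ∈ S is not an (ε,α)-outlier, i.e. π({ σ ∈ S : p(σ) ≥ p(σ_0) }) > α. Let m ≥ 1 and consider m independent trajectories of length k all started at σ_0 (i.e. the product measure (μ_k^{σ_0})^{⊗m} on (S^{k+1})^m), and let ρ be the number of trajectories on which σ_0 is an ε-outlier (i.e. the number of coordinates whose path x satisfies #{ i : ω(x_i) ≤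 ω(x_0) } ≤ ε(k+1)). Then for every r > 0, Pr( ρ ≥ m·√(2ε/α) + r ) ≤ exp( − min( r²·√(α/(2ε))/(3m), r/3 ) ). -/
open scoped Classical BigOperators

/-- Expectation of `g` applied to the list of the `n` states visited after time `0` by the chain
with transition matrix `P` started at `σ`. -/
noncomputable def pathExp {S : Type*} [Fintype S] (P : S → S → ℝ) :
    ℕ → S → (List S → ℝ) → ℝ
  | 0, _, g => g []
  | n + 1, σ, g => ∑ y, P σ y * pathExp P n y (fun l => g (y :: l))

/-- Number of entries of `l` whose label is at most `v`. -/
noncomputable def lowCount {S : Type*} (ω : S → ℝ) (v : ℝ) (l : List S) : ℕ :=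
  l.countP (fun y => decide (ω y ≤ v))

section PathExp

variable {S : Type*} [Fintype S] {P : S → S → ℝ}

lemma pathExp_const (hP1 : ∀ x, ∑ y, P x y = 1) (n : ℕ) (σ : S) (c : ℝ) :
    pathExp P n σ (fun _ => c) = c := by
  induction n generalizing σ with
  | zero => rfl
  | succ n ih => simp [pathExp, ih, ← Finset.sum_mul, hP1]

lemma pathExp_sum {ι : Type*} (s : Finset ι) (n : ℕ) (σ : S) (c : ι → ℝ) (g : ι → List S → ℝ) :
    pathExp P n σ (fun l => ∑ i ∈ s, c i * g i l) = ∑ i ∈ s, c i * pathExp P n σ (g i) := by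
  induction n generalizing σ g with
  | zero => rfl
  | succ n ih =>
    simp only [pathExp, ih, Finset.mul_sum]
    rw [Finset.sum_comm]
    exact Finset.sum_congr rfl fun i _ => Finset.sum_congr rfl fun y _ => by ring

lemma pathExp_mul_const (n : ℕ) (σ : S) (c : ℝ) (g : List S → ℝ) :
    pathExp P n σ (fun l => g l * c) = pathExp P n σ g * c := by
  simpa [mul_comm] using pathExp_sum (P := P) {()} n σ (fun _ => c) (fun _ => g)

lemma pathExp_mono (hP0 : ∀ x y, 0 ≤ P x y) (n : ℕ) (σ : S) {g h : List S → ℝ}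
    (hgh : ∀ l, l.length = n → g l ≤ h l) : pathExp P n σ g ≤ pathExp P n σ h := by
  induction n generalizing σ g h with
  | zero => exact hgh [] rfl
  | succ n ih =>
    exact Finset.sum_le_sum fun y _ => mul_le_mul_of_nonneg_left
      (ih y fun l hl => hgh (y :: l) (by simp [hl])) (hP0 σ y)

lemma pathExp_add_le (hP0 : ∀ x y, 0 ≤ P x y) (hP1 : ∀ x, ∑ y, P x y = 1) (a b : ℕ) (σ : S)
    {g h : List S → ℝ} (hgh : ∀ l l', g (l ++ l') ≤ h l) :
    pathExp P (a + b) σ g ≤ pathExp P a σ h := by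
  induction a generalizing σ g h with
  | zero =>
    rw [Nat.zero_add]
    calc pathExp P b σ g ≤ pathExp P b σ (fun _ => h []) :=
          pathExp_mono hP0 b σ fun l _ => hgh [] l
      _ = h [] := pathExp_const hP1 b σ _
  | succ a ih =>
    rw [Nat.add_right_comm]
    exact Finset.sum_le_sum fun y _ => mul_le_mul_of_nonneg_left
      (ih y fun l l' => hgh (y :: l) l') (hP0 σ y)

/-- Under detailed balance, a stationary trajectory may be generated from any of its times, running
the chain independently backwards and forwards. -/
lemma sum_pathExp_reverse {π : S → ℝ} (hdb : ∀ x y, π x * P x y = π y * P y x)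
    (Φ : List S → ℝ) (a b : ℕ) :
    ∑ σ, π σ * pathExp P a σ (fun l => pathExp P b σ (fun l' => Φ (l.reverse ++ σ :: l'))) =
      ∑ σ, π σ * pathExp P (a + b) σ (fun l => Φ (σ :: l)) := by
  induction a generalizing b with
  | zero => simp [pathExp]
  | succ a ih =>
    rw [Nat.succ_add_eq_add_succ, ← ih]
    simp only [pathExp, pathExp_sum, Finset.mul_sum, List.reverse_cons, List.append_assoc,
      List.singleton_append, ← mul_assoc]
    rw [Finset.sum_comm]
    exact Finset.sum_congr rfl fun y _ => Finset.sum_congr rfl fun σ _ => by rw [hdb]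

/-- `pathExp` as a sum over tuples of states. -/
lemma sum_paths_eq_pathExp (n : ℕ) (σ : S) (g : List S → ℝ) :
    ∑ x : Fin (n + 1) → S,
        (if x 0 = σ then ∏ i : Fin n, P (x i.castSucc) (x i.succ) else 0) * g (List.ofFn x) =
      pathExp P n σ (fun l => g (σ :: l)) := by
  induction n generalizing σ g with
  | zero =>
    rw [← (Equiv.funUnique (Fin 1) S).symm.sum_comp]
    simp [pathExp, uniqueElim]
  | succ n ih =>
    rw [← (Fin.consEquiv fun _ : Fin (n + 2) => S).sum_comp, Fintype.sum_prod_type]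
    rw [Finset.sum_eq_single σ (fun τ _ hτ => by simp [hτ]) (by simp)]
    simp only [pathExp]
    simp_rw [← fun y => ih y fun l => g (σ :: l), Finset.mul_sum]
    rw [Finset.sum_comm]
    refine Finset.sum_congr rfl fun x _ => ?_
    rw [Finset.sum_eq_single (x 0) (fun y _ hy => by simp [hy.symm]) (by simp)]
    simp [Fin.prod_univ_succ (n := n), mul_assoc]

end PathExp

section LowCount

variable {S : Type*} (ω : S → ℝ)

lemma card_filter_range_getD (d : S) (v : ℝ) (l : List S) :
    ((Finset.range l.length).filter fun i => ω (l.getD i d) ≤ v).card = lowCount ω v l := by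
  rw [Finset.card_filter]
  induction l with
  | nil => rfl
  | cons y l ih =>
    rw [List.length_cons, Finset.sum_range_succ']
    simp only [List.getD_cons_succ, List.getD_cons_zero, ih]
    simp [lowCount, List.countP_cons]

lemma lowCount_ofFn (v : ℝ) {n : ℕ} (x : Fin n → S) :
    lowCount ω v (List.ofFn x) = (Finset.univ.filter fun i => ω (x i) ≤ v).card := by
  rw [Finset.card_filter]
  induction n with
  | zero => simp [lowCount]
  | succ n ih =>
    have := ih fun i => x i.succ
    rw [Fin.sum_univ_succ, ← this, List.ofFn_succ]
    simp [lowCount, List.countP_cons, add_comm]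

/-- At most `c` entries of a list are among its `c` lowest ones. -/
lemma card_filter_lowCount_le (d : S) (l : List S) {c : ℝ} (hc : 0 ≤ c) :
    (((Finset.range l.length).filter fun i =>
      (lowCount ω (ω (l.getD i d)) l : ℝ) ≤ c).card : ℝ) ≤ c := by
  set J := (Finset.range l.length).filter fun i => (lowCount ω (ω (l.getD i d)) l : ℝ) ≤ c with hJ
  rcases J.eq_empty_or_nonempty with h | h
  · simpa [h] using hc
  · obtain ⟨i, hi, hmax⟩ := J.exists_max_image (fun i => ω (l.getD i d)) h
    refine le_trans ?_ (Finset.mem_filter.1 hi).2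
    rw [← card_filter_range_getD ω d]
    exact_mod_cast Finset.card_le_card fun j hj =>
      Finset.mem_filter.2 ⟨(Finset.mem_filter.1 hj).1, hmax j hj⟩

end LowCount

/-- The stationary second moment of the probability of being an `ε`-outlier of one's own trajectory
is at most `2ε`. -/
lemma sum_mul_pathExp_sq_le {S : Type*} [Fintype S] [Nonempty S]
    {P : S → S → ℝ} (hP0 : ∀ x y, 0 ≤ P x y) (hP1 : ∀ x, ∑ y, P x y = 1)
    {π : S → ℝ} (hπ0 : ∀ x, 0 ≤ π x) (hπ1 : ∑ x, π x = 1)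
    (hdb : ∀ x y, π x * P x y = π y * P y x) (k : ℕ) {ε : ℝ} (hε : 0 ≤ ε) (ω : S → ℝ) :
    ∑ σ, π σ * pathExp P k σ
      (fun l => if (lowCount ω (ω σ) (σ :: l) : ℝ) ≤ ε * (k + 1) then 1 else 0) ^ 2 ≤ 2 * ε := by
  set c := ε * (k + 1) with hc
  have hc0 : 0 ≤ c := by positivity
  set q : S → ℝ := fun σ =>
    pathExp P k σ (fun l => if (lowCount ω (ω σ) (σ :: l) : ℝ) ≤ c then 1 else 0) with hq
  have hq0 (σ : S) : 0 ≤ q σ := by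
    rw [← pathExp_const hP1 k σ 0]
    exact pathExp_mono hP0 k σ fun l _ => by split_ifs <;> norm_num
  have hprefix (σ : S) (a b : ℕ) (hab : a + b = k) : q σ ≤
      pathExp P a σ (fun l => if (lowCount ω (ω σ) (σ :: l) : ℝ) ≤ c then 1 else 0) := by
    simp only [hq, ← hab]
    refine pathExp_add_le hP0 hP1 a b σ fun l l' => ?_
    have : (lowCount ω (ω σ) (σ :: l) : ℝ) ≤ lowCount ω (ω σ) (σ :: (l ++ l')) := by
      exact_mod_cast List.Sublist.countP_le (by simp)
    split_ifs <;> linarith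
  obtain ⟨d⟩ := ‹Nonempty S›
  let Φ : ℕ → List S → ℝ := fun j l =>
    if (lowCount ω (ω (l.getD j d)) l : ℝ) ≤ 2 * c then 1 else 0
  have hmid (j : ℕ) (hj : j ∈ Finset.range (k + 1)) :
      ∑ σ, π σ * q σ ^ 2 ≤ ∑ σ, π σ * pathExp P k σ (fun l => Φ j (σ :: l)) := by
    have hjk : j + (k - j) = k := by have := Finset.mem_range.1 hj; omega
    conv_rhs => rw [← hjk]
    rw [← sum_pathExp_reverse hdb]
    refine Finset.sum_le_sum fun σ _ => mul_le_mul_of_nonneg_left ?_ (hπ0 σ)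
    set A : List S → ℝ := fun l => if (lowCount ω (ω σ) (σ :: l) : ℝ) ≤ c then 1 else 0
    calc q σ ^ 2 = q σ * q σ := sq _
      _ ≤ pathExp P j σ A * pathExp P (k - j) σ A :=
        mul_le_mul (hprefix σ j (k - j) hjk) (hprefix σ (k - j) j (by omega)) (hq0 σ)
          ((hq0 σ).trans (hprefix σ j (k - j) hjk))
      _ = pathExp P j σ (fun l => pathExp P (k - j) σ (fun l' => A l' * A l)) := by
        simp only [pathExp_mul_const, mul_comm (pathExp P (k - j) σ A)]
      _ ≤ _ := by
        refine pathExp_mono hP0 j σ fun l hl => pathExp_mono hP0 (k - j) σ fun l' _ => ?_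
        have hget : (l.reverse ++ σ :: l').getD j d = σ := by
          rw [List.getD_append_right _ _ _ _ (by simp [hl])]
          simp [hl]
        have hcount : (lowCount ω (ω σ) (l.reverse ++ σ :: l') : ℝ) ≤
            lowCount ω (ω σ) (σ :: l) + lowCount ω (ω σ) (σ :: l') := by
          norm_cast
          simp only [lowCount, List.countP_append, List.countP_reverse, List.countP_cons]
          omega
        simp only [A, Φ, hget]
        split_ifs <;> linarith
  have hsum : ((k : ℝ) + 1) * ∑ σ, π σ * q σ ^ 2 ≤ 2 * c := by
    calc ((k : ℝ) + 1) * ∑ σ, π σ * q σ ^ 2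
        = ∑ j ∈ Finset.range (k + 1), ∑ σ, π σ * q σ ^ 2 := by simp
      _ ≤ ∑ j ∈ Finset.range (k + 1), ∑ σ, π σ * pathExp P k σ (fun l => Φ j (σ :: l)) :=
        Finset.sum_le_sum hmid
      _ = ∑ σ, π σ * pathExp P k σ
            (fun l => ∑ j ∈ Finset.range (k + 1), 1 * Φ j (σ :: l)) := by
        rw [Finset.sum_comm]
        exact Finset.sum_congr rfl fun σ _ => by
          rw [pathExp_sum, Finset.mul_sum]
          simp only [one_mul]
      _ ≤ ∑ σ, π σ * (2 * c) := by
        refine Finset.sum_le_sum fun σ _ => mul_le_mul_of_nonneg_left ?_ (hπ0 σ)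
        rw [← pathExp_const hP1 k σ (2 * c)]
        refine pathExp_mono hP0 k σ fun l hl => ?_
        have := card_filter_lowCount_le ω d (σ :: l) (c := 2 * c) (by positivity)
        rw [List.length_cons, hl, Finset.card_filter] at this
        simpa [Φ] using this
      _ = 2 * c := by rw [← Finset.sum_mul, hπ1, one_mul]
  have hk : (0 : ℝ) < k + 1 := by positivity
  refine le_of_mul_le_mul_left ?_ hk
  calc _ ≤ 2 * c := hsum
    _ = _ := by rw [hc]; ring

/-- Bennett-type estimate for the exponent in the multiplicative Chernoff bound. -/
lemma min_le_add_mul_log_sub {x : ℝ} (hx : 0 < x) :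
    min (x ^ 2 / 3) (x / 3) ≤ (1 + x) * Real.log (1 + x) - x := by
  have hlog := Real.le_log_one_add_of_nonneg hx.le
  have h : x ^ 2 / (x + 2) ≤ (1 + x) * Real.log (1 + x) - x := by
    have := mul_le_mul_of_nonneg_left hlog (by positivity : (0 : ℝ) ≤ 1 + x)
    have e : (1 + x) * (2 * x / (x + 2)) = x ^ 2 / (x + 2) + x := by
      field_simp
      ring
    linarith
  refine le_trans ?_ h
  rcases le_total x 1 with h1 | h1
  · refine (min_le_left _ _).trans ?_
    gcongr
    linarith
  · refine (min_le_right _ _).trans ?_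
    rw [div_le_div_iff₀ (by norm_num) (by positivity)]
    nlinarith

/-- Chernoff bound for the number of successes in `m` independent samples from the distribution with
weights `w`, with success probability at most `s`. -/
lemma sum_prod_filter_le_exp {Ω : Type*} [Fintype Ω] {w : Ω → ℝ} (hw0 : ∀ x, 0 ≤ w x)
    (hw1 : ∑ x, w x = 1) (O : Ω → Prop) {s : ℝ} (hs : 0 < s)
    (hO : ∑ x, w x * (if O x then 1 else 0) ≤ s) {m : ℕ} (hm : 1 ≤ m) {r : ℝ} (hr : 0 < r) :
    ∑ X ∈ Finset.univ.filter (fun X : Fin m → Ω =>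
        (m : ℝ) * s + r ≤ ((Finset.univ.filter fun j => O (X j)).card : ℝ)), ∏ j, w (X j) ≤
      Real.exp (-(min (r ^ 2 / s / (3 * m)) (r / 3))) := by
  have hm0 : (0 : ℝ) < m := by exact_mod_cast hm
  set x := r / (m * s) with hx
  have hx0 : 0 < x := by positivity
  have hrx : r = m * s * x := by rw [hx]; field_simp
  set t := Real.log (1 + x) with ht
  have ht0 : 0 ≤ t := Real.log_nonneg (by linarith)
  have hexp : Real.exp t = 1 + x := Real.exp_log (by linarith)
  set f : Ω → ℝ := fun y => w y * (if O y then 1 + x else 1) with hf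
  have hfsum : ∑ y, f y ≤ Real.exp (x * s) := by
    have e : ∑ y, f y = ∑ y, w y + x * ∑ y, w y * (if O y then 1 else 0) := by
      rw [Finset.mul_sum, ← Finset.sum_add_distrib]
      exact Finset.sum_congr rfl fun y _ => by simp only [hf]; split_ifs <;> ring
    rw [e, hw1]
    nlinarith [Real.add_one_le_exp (x * s), mul_le_mul_of_nonneg_left hO hx0.le]
  have hf0 (y : Ω) : 0 ≤ f y := mul_nonneg (hw0 y) (by split_ifs <;> linarith)
  have hprod (X : Fin m → Ω) : ∏ j, f (X j) =
      (∏ j, w (X j)) * Real.exp (t * (Finset.univ.filter fun j => O (X j)).card) := by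
    rw [mul_comm t, Real.exp_nat_mul, hexp]
    rw [Finset.prod_mul_distrib]
    simp [Finset.prod_ite]
  calc _ ≤ ∑ X ∈ Finset.univ.filter (fun X : Fin m → Ω =>
        (m : ℝ) * s + r ≤ ((Finset.univ.filter fun j => O (X j)).card : ℝ)),
          Real.exp (-(t * (m * s + r))) * ∏ j, f (X j) := by
        refine Finset.sum_le_sum fun X hX => ?_
        rw [hprod, mul_left_comm, ← Real.exp_add]
        refine le_mul_of_one_le_right (Finset.prod_nonneg fun j _ => hw0 _) (Real.one_le_exp ?_)
        nlinarith [mul_le_mul_of_nonneg_left (Finset.mem_filter.1 hX).2 ht0]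
    _ ≤ ∑ X : Fin m → Ω, Real.exp (-(t * (m * s + r))) * ∏ j, f (X j) :=
        Finset.sum_le_sum_of_subset_of_nonneg (Finset.subset_univ _) fun X _ _ =>
          mul_nonneg (Real.exp_nonneg _) (Finset.prod_nonneg fun j _ => hf0 _)
    _ = Real.exp (-(t * (m * s + r))) * (∑ y, f y) ^ m := by
        rw [← Finset.mul_sum, Finset.sum_pow', Fintype.piFinset_univ]
    _ ≤ Real.exp (-(t * (m * s + r))) * Real.exp (x * s) ^ m := by
        gcongr
        exact Finset.sum_nonneg fun y _ => hf0 y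
    _ = Real.exp (-(m * s * ((1 + x) * t - x))) := by
        rw [← Real.exp_nat_mul, ← Real.exp_add, hrx]
        congr 1
        ring
    _ ≤ _ := by
        refine Real.exp_le_exp.2 (neg_le_neg ?_)
        have := mul_le_mul_of_nonneg_left (min_le_add_mul_log_sub hx0)
          (by positivity : (0 : ℝ) ≤ m * s)
        refine le_trans (le_of_eq ?_) this
        rw [mul_min_of_nonneg _ _ (by positivity : (0 : ℝ) ≤ m * s), hrx]
        congr 1 <;> field_simp

/-- CFMP test: let `π` be a probability distribution in detailed balance with the
row-stochastic transition matrix `P`, let `p σ` be the probability that `σ` is an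
`ε`-outlier of a length-`k` trajectory of the chain started at `σ`, and suppose
`σ₀` is not an `(ε, α)`-outlier, i.e. `π {σ : p σ ≥ p σ₀} > α`. Run `m` independent
length-`k` trajectories from `σ₀`, and let `ρ` be the number of trajectories on
which `σ₀` is an `ε`-outlier. Then for every `r > 0`,
`Pr(ρ ≥ m √(2ε/α) + r) ≤ exp(−min(r² √(α/(2ε)) / (3m), r/3))`. -/
theorem cfmp_test {S : Type*} [Fintype S] [Nonempty S]
    (P : S → S → ℝ) (hP0 : ∀ x y, 0 ≤ P x y) (hP1 : ∀ x, ∑ y, P x y = 1)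
    (π : S → ℝ) (hπ0 : ∀ x, 0 ≤ π x) (hπ1 : ∑ x, π x = 1)
    (hdb : ∀ x y, π x * P x y = π y * P y x)
    (k : ℕ) (hk : 1 ≤ k) (ε α : ℝ) (hε : 0 < ε) (hα : 0 < α) (ω : S → ℝ)
    (p : S → ℝ)
    (hp : ∀ σ : S, p σ =
      ∑ x ∈ Finset.univ.filter (fun x : Fin (k + 1) → S =>
          x 0 = σ ∧
          ((Finset.univ.filter (fun i : Fin (k + 1) => ω (x i) ≤ ω (x 0))).card : ℝ)
            ≤ ε * (k + 1)),
        ∏ i : Fin k, P (x i.castSucc) (x i.succ))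
    (σ₀ : S)
    (hout : α < ∑ σ ∈ Finset.univ.filter (fun σ => p σ₀ ≤ p σ), π σ)
    (m : ℕ) (hm : 1 ≤ m) (r : ℝ) (hr : 0 < r) :
    ∑ X ∈ Finset.univ.filter (fun X : Fin m → (Fin (k + 1) → S) =>
        (m : ℝ) * Real.sqrt (2 * ε / α) + r ≤
          ((Finset.univ.filter (fun j : Fin m =>
            ((Finset.univ.filter (fun i : Fin (k + 1) =>
                ω (X j i) ≤ ω (X j 0))).card : ℝ) ≤ ε * (k + 1))).card : ℝ)),
      ∏ j : Fin m,
        (if X j 0 = σ₀ then ∏ i : Fin k, P (X j i.castSucc) (X j i.succ) else 0)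
    ≤ Real.exp (-(min (r ^ 2 * Real.sqrt (α / (2 * ε)) / (3 * m)) (r / 3))) := by
  set O : (Fin (k + 1) → S) → Prop := fun x =>
    ((Finset.univ.filter (fun i : Fin (k + 1) => ω (x i) ≤ ω (x 0))).card : ℝ) ≤ ε * (k + 1)
    with hO
  set w : (Fin (k + 1) → S) → ℝ := fun x =>
    if x 0 = σ₀ then ∏ i : Fin k, P (x i.castSucc) (x i.succ) else 0 with hw
  have hp' (σ : S) : p σ = pathExp P k σ
      (fun l => if (lowCount ω (ω σ) (σ :: l) : ℝ) ≤ ε * (k + 1) then 1 else 0) := by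
    rw [hp, ← sum_paths_eq_pathExp k σ
      (fun l => if (lowCount ω (ω σ) l : ℝ) ≤ ε * (k + 1) then 1 else 0), Finset.sum_filter]
    refine Finset.sum_congr rfl fun x _ => ?_
    rw [lowCount_ofFn]
    by_cases h : x 0 = σ
    · simp [h]
    · simp [h]
  have hsq : ∑ σ, π σ * p σ ^ 2 ≤ 2 * ε := by
    simpa only [hp'] using sum_mul_pathExp_sq_le hP0 hP1 hπ0 hπ1 hdb k hε.le ω
  have hp0 (σ : S) : 0 ≤ p σ := by
    rw [hp]
    exact Finset.sum_nonneg fun x _ => Finset.prod_nonneg fun i _ => hP0 _ _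
  have hpσ₀ : p σ₀ ≤ Real.sqrt (2 * ε / α) := by
    refine Real.le_sqrt_of_sq_le ?_
    rw [le_div_iff₀' hα]
    calc α * p σ₀ ^ 2 ≤ (∑ σ ∈ Finset.univ.filter (fun σ => p σ₀ ≤ p σ), π σ) * p σ₀ ^ 2 := by
          gcongr
      _ ≤ ∑ σ ∈ Finset.univ.filter (fun σ => p σ₀ ≤ p σ), π σ * p σ ^ 2 := by
          rw [Finset.sum_mul]
          refine Finset.sum_le_sum fun σ hσ => ?_
          have := (Finset.mem_filter.1 hσ).2
          exact mul_le_mul_of_nonneg_left (pow_le_pow_left₀ (hp0 σ₀) this 2) (hπ0 σ)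
      _ ≤ ∑ σ, π σ * p σ ^ 2 :=
          Finset.sum_le_sum_of_subset_of_nonneg (Finset.subset_univ _) fun σ _ _ =>
            mul_nonneg (hπ0 σ) (sq_nonneg _)
      _ ≤ 2 * ε := hsq
  have hw0 (x : Fin (k + 1) → S) : 0 ≤ w x := by
    simp only [hw]
    split_ifs
    · exact Finset.prod_nonneg fun i _ => hP0 _ _
    · exact le_rfl
  have hw1 : ∑ x, w x = 1 := by
    simpa [pathExp_const hP1] using sum_paths_eq_pathExp (P := P) k σ₀ (fun _ => 1)
  have hwO : ∑ x, w x * (if O x then 1 else 0) ≤ Real.sqrt (2 * ε / α) := by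
    refine le_of_eq_of_le ?_ hpσ₀
    rw [hp, Finset.sum_filter]
    exact Finset.sum_congr rfl fun x _ => by
      by_cases h : x 0 = σ₀ <;> simp [hw, hO, h]
  have hinv : Real.sqrt (α / (2 * ε)) = (Real.sqrt (2 * ε / α))⁻¹ := by
    rw [← Real.sqrt_inv, inv_div]
  rw [hinv, ← div_eq_mul_inv]
  exact sum_prod_filter_le_exp hw0 hw1 O (Real.sqrt_pos.2 (by positivity)) hwO hm hr
end
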